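/- If D = dH − Σ_i m_i E_i − Σ_{i<j} m_{ij} E_{ij} satisfies the boundary inequalities and moreover d = m_{12} + m_{34}, then D is a nonnegative real linear combination of the 25 boundary classes and the 15 Keel–Vermeire classes. (Case 2 of the proof of Theorem 1.3 for n = 6.) -/

import Mathlib

open Finset

/-- Index type for the Kapranov basis of `Pic(M̄₀,₆) ⊗ ℝ`:
`H`, `E_i` (i ∈ Fin 5), and `E_{ij}` for `i < j`. -/
abbrev PairIdx : Type := {p : Fin 5 × Fin 5 // p.1 < p.2}

abbrev Idx : Type := Unit ⊕ Fin 5 ⊕ PairIdx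

/-- The 16-dimensional real vector space `N¹(M̄₀,₆)`. -/
abbrev V : Type := Idx → ℝ

noncomputable section

/-- The hyperplane class `H`. -/
def bH : V := fun k => if k = Sum.inl () then 1 else 0

/-- The exceptional class `E_i` over the point `p_i`. -/
def bE (i : Fin 5) : V := fun k => if k = Sum.inr (Sum.inl i) then 1 else 0

/-- The exceptional class `E_{ij} = E_{ji}` over the line `l_{ij}` (for `i ≠ j`). -/
def bEE (i j : Fin 5) : V := fun k =>
  match k with
  | Sum.inr (Sum.inr p) =>
      if (p.1.1 = i ∧ p.1.2 = j) ∨ (p.1.1 = j ∧ p.1.2 = i) then 1 else 0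
  | _ => 0

/-- `D = d·H − Σᵢ mᵢ Eᵢ − Σ_{i<j} m_{ij} E_{ij}`. -/
def Dvec (d : ℝ) (m : Fin 5 → ℝ) (mm : Fin 5 → Fin 5 → ℝ) : V :=
  d • bH - ∑ i, m i • bE i - ∑ p : PairIdx, mm p.1.1 p.1.2 • bEE p.1.1 p.1.2

/-- The boundary inequalities: `D` restricts to an effective class on each
boundary divisor of `M̄₀,₆`. -/
def BoundaryIneqs (d : ℝ) (m : Fin 5 → ℝ) (mm : Fin 5 → Fin 5 → ℝ) : Prop :=
  (∀ i j, i ≠ j → mm i j ≤ m i) ∧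
  (∀ i, (∑ j ∈ univ.filter (fun j => j ≠ i), mm i j) ≤ 2 * m i) ∧
  (∀ i j k, i ≠ j → i ≠ k → j ≠ k → m i + mm j k ≤ d) ∧
  (∀ i j k h l : Fin 5, ({i, j, k, h, l} : Finset (Fin 5)) = univ →
    m i + m j + m k + mm h l ≤ 2 * d) ∧
  (∀ i j k h l : Fin 5, ({i, j, k, h, l} : Finset (Fin 5)) = univ →
    mm i j + mm i k + mm j k + mm h l ≤ d) ∧
  (∀ i j, i ≠ j → 0 ≤ mm i j) ∧
  (∀ i j, i ≠ j → m i + m j ≤ d + mm i j)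

/-- The boundary class `Δ_{ijk}`. -/
def Delta (i j k : Fin 5) : V :=
  bH - bE i - bE j - bE k - bEE i j - bEE i k - bEE j k

/-- The Keel–Vermeire class `KV_{ij,kh}`. -/
def KV (i j k h : Fin 5) : V :=
  (2 : ℝ) • bH - ∑ a, bE a - bEE i k - bEE i h - bEE j k - bEE j h

/-- The 25 boundary classes `E_i`, `E_{ij}`, `Δ_{ijk}`. -/
def BoundaryClasses : Set V :=
  {v | (∃ i, v = bE i) ∨ (∃ i j, i ≠ j ∧ v = bEE i j) ∨
    (∃ i j k, i ≠ j ∧ i ≠ k ∧ j ≠ k ∧ v = Delta i j k)}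

/-- The 15 Keel–Vermeire classes. -/
def KVClasses : Set V :=
  {v | ∃ i j k h : Fin 5, i ≠ j ∧ i ≠ k ∧ i ≠ h ∧ j ≠ k ∧ j ≠ h ∧ k ≠ h ∧
    v = KV i j k h}

/-- `v` is a nonnegative real linear combination of elements of `S`. -/
def IsNonnegCombi (S : Set V) (v : V) : Prop :=
  ∃ (n : ℕ) (c : Fin n → ℝ) (g : Fin n → V),
    (∀ t, 0 ≤ c t) ∧ (∀ t, g t ∈ S) ∧ v = ∑ t, c t • g t

end

lemma IsNonnegCombi.smul_mem {S : Set V} {g : V} {c : ℝ} (hc : 0 ≤ c) (hg : g ∈ S) :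
    IsNonnegCombi S (c • g) :=
  ⟨1, fun _ => c, fun _ => g, fun _ => hc, fun _ => hg, by simp⟩

lemma IsNonnegCombi.add {S : Set V} {v w : V} (hv : IsNonnegCombi S v)
    (hw : IsNonnegCombi S w) : IsNonnegCombi S (v + w) := by
  obtain ⟨n, c, g, hc, hg, rfl⟩ := hv
  obtain ⟨n', c', g', hc', hg', rfl⟩ := hw
  refine ⟨n + n', Fin.append c c', Fin.append g g', fun t => ?_, fun t => ?_, ?_⟩
  · refine Fin.addCases (fun s => ?_) (fun s => ?_) t
    · simpa using hc s
    · simpa using hc' s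
  · refine Fin.addCases (fun s => ?_) (fun s => ?_) t
    · simpa using hg s
    · simpa using hg' s
  · simp [Fin.sum_univ_add]

lemma bE_mem (i : Fin 5) : bE i ∈ BoundaryClasses ∪ KVClasses :=
  Or.inl (Or.inl ⟨i, rfl⟩)

lemma bEE_mem {i j : Fin 5} (hij : i ≠ j) : bEE i j ∈ BoundaryClasses ∪ KVClasses :=
  Or.inl (Or.inr (Or.inl ⟨i, j, hij, rfl⟩))

lemma Delta_mem {i j k : Fin 5} (hij : i ≠ j) (hik : i ≠ k) (hjk : j ≠ k) :
    Delta i j k ∈ BoundaryClasses ∪ KVClasses :=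
  Or.inl (Or.inr (Or.inr ⟨i, j, k, hij, hik, hjk, rfl⟩))

lemma KV_mem {i j k h : Fin 5} (hij : i ≠ j) (hik : i ≠ k) (hih : i ≠ h) (hjk : j ≠ k)
    (hjh : j ≠ h) (hkh : k ≠ h) : KV i j k h ∈ BoundaryClasses ∪ KVClasses :=
  Or.inr ⟨i, j, k, h, hij, hik, hih, hjk, hjh, hkh, rfl⟩

lemma Dvec_apply_H (d : ℝ) (m : Fin 5 → ℝ) (mm : Fin 5 → Fin 5 → ℝ) :
    Dvec d m mm (Sum.inl ()) = d := by
  simp [Dvec, bH, bE, bEE]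

lemma Dvec_apply_E (d : ℝ) (m : Fin 5 → ℝ) (mm : Fin 5 → Fin 5 → ℝ) (i : Fin 5) :
    Dvec d m mm (Sum.inr (Sum.inl i)) = -m i := by
  simp [Dvec, bH, bE, bEE]

lemma Dvec_apply_EE (d : ℝ) (m : Fin 5 → ℝ) (mm : Fin 5 → Fin 5 → ℝ) (p : PairIdx) :
    Dvec d m mm (Sum.inr (Sum.inr p)) = -mm p.1.1 p.1.2 := by
  have key : ∀ q : PairIdx,
      mm q.1.1 q.1.2 * bEE q.1.1 q.1.2 (Sum.inr (Sum.inr p)) =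
        if q = p then mm p.1.1 p.1.2 else 0 := by
    intro q
    by_cases hqp : q = p
    · subst hqp
      simp [bEE]
    · have hne : ¬((p.1.1 = q.1.1 ∧ p.1.2 = q.1.2) ∨ (p.1.1 = q.1.2 ∧ p.1.2 = q.1.1)) := by
        rintro (⟨h₁, h₂⟩ | ⟨h₁, h₂⟩)
        · exact hqp (Subtype.ext (Prod.ext h₁.symm h₂.symm))
        · have hp := p.2
          rw [h₁, h₂] at hp
          exact lt_asymm hp q.2
      simp only [bEE, if_neg hne, if_neg hqp, mul_zero]
  have hsum : (∑ q : PairIdx, mm q.1.1 q.1.2 • bEE q.1.1 q.1.2) (Sum.inr (Sum.inr p)) =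
      mm p.1.1 p.1.2 := by
    simp only [Finset.sum_apply, Pi.smul_apply, smul_eq_mul, key]
    simp
  rw [Dvec, Pi.sub_apply, hsum]
  simp [bH, bE]

/-- A divisor class with `m₁₂ = m₁ = m₂ = a`, `m₃₄ = m₃ = m₄ = b`, `d = a + b` and
`m_{i5} = 0` decomposes over `Δ₁₂₃, Δ₁₂₄, Δ₃₄₅`, two Keel–Vermeire classes and exceptional
classes, with explicit coefficients. -/
lemma Dvec_eq_combination {d : ℝ} {m : Fin 5 → ℝ} {mm : Fin 5 → Fin 5 → ℝ} {u v w A B : ℝ}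
    (hd : d = mm 0 1 + mm 2 3)
    (h0 : m 0 = mm 0 1) (h1 : m 1 = mm 0 1) (h2 : m 2 = mm 2 3) (h3 : m 3 = mm 2 3)
    (h04 : mm 0 4 = 0) (h14 : mm 1 4 = 0) (h24 : mm 2 4 = 0) (h34 : mm 3 4 = 0)
    (hB : u + B = mm 0 2) (hA : u + A = mm 1 2)
    (hv : v = mm 0 1 - u - A - B) (hw : w = mm 2 3 - A - B) :
    Dvec d m mm =
      u • Delta 0 1 2 + v • Delta 0 1 3 + w • Delta 2 3 4 + A • KV 0 2 1 3 + B • KV 0 3 1 2 +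
      u • bE 2 + v • bE 3 + (mm 2 3 - m 4) • bE 4 +
      (mm 0 1 - mm 0 2 - mm 0 3) • bEE 0 3 + (mm 0 1 - mm 1 2 - mm 1 3) • bEE 1 3 +
      w • bEE 2 4 + w • bEE 3 4 := by
  subst hv hw
  ext k
  rcases k with ⟨⟩ | i | p
  · rw [Dvec_apply_H]
    simp [Delta, KV, bH, bE, bEE]
    linarith
  · rw [Dvec_apply_E]
    fin_cases i <;> simp [Delta, KV, bH, bE, bEE] <;> linarith
  · rw [Dvec_apply_EE]
    obtain ⟨⟨i, j⟩, hij⟩ := p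
    fin_cases i <;> fin_cases j <;> first
      | exact absurd hij (by decide)
      | (simp [Delta, KV, bH, bE, bEE]; try linarith)

/-- **Case 2 of the proof of Theorem 1.3 (n = 6).**  Paper indices `1,2,3,4,5`
correspond to `0,1,2,3,4 : Fin 5`.  If `D` satisfies the boundary inequalities
and `d = m_{12} + m_{34}`, then `D` is a nonnegative linear combination of the
25 boundary classes and the 15 Keel–Vermeire classes. -/
theorem case2_effective
    (d : ℝ) (m : Fin 5 → ℝ) (mm : Fin 5 → Fin 5 → ℝ)
    (hsymm : ∀ i j, mm i j = mm j i)
    (h : BoundaryIneqs d m mm)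
    (hd : d = mm 0 1 + mm 2 3) :
    IsNonnegCombi (BoundaryClasses ∪ KVClasses) (Dvec d m mm) := by
  obtain ⟨hle, -, htri, -, hfour, hnonneg, -⟩ := h
  have h0 : m 0 = mm 0 1 := by
    linarith [hle 0 1 (by decide), htri 0 2 3 (by decide) (by decide) (by decide)]
  have h1 : m 1 = mm 0 1 := by
    linarith [hle 1 0 (by decide), htri 1 2 3 (by decide) (by decide) (by decide), hsymm 0 1]
  have h2 : m 2 = mm 2 3 := by
    linarith [hle 2 3 (by decide), htri 2 0 1 (by decide) (by decide) (by decide)]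
  have h3 : m 3 = mm 2 3 := by
    linarith [hle 3 2 (by decide), htri 3 0 1 (by decide) (by decide) (by decide), hsymm 2 3]
  have h4 : m 4 ≤ mm 2 3 := by
    linarith [htri 4 0 1 (by decide) (by decide) (by decide)]
  have n04 := hnonneg 0 4 (by decide)
  have n14 := hnonneg 1 4 (by decide)
  have n24 := hnonneg 2 4 (by decide)
  have n34 := hnonneg 3 4 (by decide)
  have f014 := hfour 0 1 4 2 3 (by decide)
  have f234 := hfour 2 3 4 0 1 (by decide)
  have z04 : mm 0 4 = 0 := by linarith
  have z14 : mm 1 4 = 0 := by linarith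
  have z24 : mm 2 4 = 0 := by linarith
  have z34 : mm 3 4 = 0 := by linarith
  have r0 : mm 0 2 + mm 0 3 ≤ mm 0 1 := by
    linarith [hfour 0 2 3 1 4 (by decide)]
  have r1 : mm 1 2 + mm 1 3 ≤ mm 0 1 := by
    linarith [hfour 1 2 3 0 4 (by decide)]
  have n02 := hnonneg 0 2 (by decide)
  have n12 := hnonneg 1 2 (by decide)
  have n03 := hnonneg 0 3 (by decide)
  have n13 := hnonneg 1 3 (by decide)
  have b02 : mm 0 2 ≤ mm 2 3 := by
    linarith [hle 2 0 (by decide), hsymm 0 2]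
  have b12 : mm 1 2 ≤ mm 2 3 := by
    linarith [hle 2 1 (by decide), hsymm 1 2]
  obtain ⟨u, A, B, hu, hA, hB, hv, hw, huB, huA⟩ : ∃ u A B : ℝ, 0 ≤ u ∧ 0 ≤ A ∧ 0 ≤ B ∧
      0 ≤ mm 0 1 - u - A - B ∧ 0 ≤ mm 2 3 - A - B ∧ u + B = mm 0 2 ∧ u + A = mm 1 2 := by
    rcases le_total (mm 0 2) (mm 1 2) with hc | hc
    · refine ⟨mm 0 2, mm 1 2 - mm 0 2, 0, ?_, ?_, ?_, ?_, ?_, ?_, ?_⟩ <;> linarith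
    · refine ⟨mm 1 2, 0, mm 0 2 - mm 1 2, ?_, ?_, ?_, ?_, ?_, ?_, ?_⟩ <;> linarith
  rw [Dvec_eq_combination hd h0 h1 h2 h3 z04 z14 z24 z34 huB huA rfl rfl]
  refine .add (.add (.add (.add (.add (.add (.add (.add (.add (.add (.add ?_ ?_) ?_) ?_) ?_) ?_)
    ?_) ?_) ?_) ?_) ?_) ?_
  · exact .smul_mem hu (Delta_mem (by decide) (by decide) (by decide))
  · exact .smul_mem hv (Delta_mem (by decide) (by decide) (by decide))
  · exact .smul_mem hw (Delta_mem (by decide) (by decide) (by decide))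
  · exact .smul_mem hA (KV_mem (by decide) (by decide) (by decide) (by decide) (by decide)
      (by decide))
  · exact .smul_mem hB (KV_mem (by decide) (by decide) (by decide) (by decide) (by decide)
      (by decide))
  · exact .smul_mem hu (bE_mem 2)
  · exact .smul_mem hv (bE_mem 3)
  · exact .smul_mem (by linarith) (bE_mem 4)
  · exact .smul_mem (by linarith) (bEE_mem (by decide))
  · exact .smul_mem (by linarith) (bEE_mem (by decide))
  · exact .smul_mem hw (bEE_mem (by decide))
  · exact .smul_mem hw (bEE_mem (by decide))
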